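/- Let p be a prime and F a field with char F = p. Define the (p+1)×(2p+3) matrix H over F whose i-th column (for i ∈ Fin(p+1)) is e_i, whose (p+1+i)-th column (for i ∈ Fin(p+1)) is 𝟙 - e_{p+1-i} (i.e., column p+2+k is Σ_{j ≠ 2p+3-(p+2+k)} e_j in 1-based indexing), and whose last column is 𝟙. Then: (a) the first p+1 columns form a basis of F^(p+1); (b) for each i ∈ [p+1], the columns indexed by ([p+1]\{i}) ∪ {2p+3-i} are minimally linearly dependent; (c) for each i ∈ [p+1], the columns indexed by {i, 2p+3-i, 2p+3} are minimally linearly dependent; (d) the columns indexed by [p+2 : 2p+2] are minimally linearly dependent. -/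

import Mathlib

/-- The columns of the (p+1)×(2p+3) matrix H_p (0-based indexing):
column k = e_k for k < p+1, column k = 𝟙 - e_{p - (k-(p+1))} for p+1 ≤ k < 2p+2
(so in 1-based terms column p+1+i equals 𝟙 - e_{p+1-i}), and the last column is 𝟙. -/
noncomputable def pFanoCol (F : Type*) [Field F] (p : ℕ) (k : Fin (2 * p + 3)) :
    Fin (p + 1) → F :=
  if hk : (k : ℕ) < p + 1 then Pi.single (⟨k, hk⟩ : Fin (p + 1)) 1
  else if (k : ℕ) < 2 * p + 2 then
    (fun _ => 1) - Pi.single (⟨p - ((k : ℕ) - (p + 1)), by omega⟩ : Fin (p + 1)) 1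
  else fun _ => 1

/-- A finite family of columns is minimally linearly dependent (a circuit):
dependent, but removing any one member leaves an independent family. -/
def MinimallyDependent (F : Type*) [Field F] {ι V : Type*} [DecidableEq ι]
    [AddCommGroup V] [Module F V] (f : ι → V) (s : Finset ι) : Prop :=
  ¬ LinearIndependent F (fun x : s => f x.1) ∧
    ∀ j ∈ s, LinearIndependent F (fun x : (s.erase j) => f x.1)

theorem minimallyDependent_of_relations {F ι V : Type*} [Field F] [DecidableEq ι]
    [AddCommGroup V] [Module F V] {f : ι → V} {s : Finset ι} (c : ι → F)
    (hc : ∑ x ∈ s, c x • f x = 0) (hc' : ∃ x ∈ s, c x ≠ 0)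
    (h : ∀ g : ι → F, ∑ x ∈ s, g x • f x = 0 → ∀ j ∈ s, g j = 0 → ∀ x ∈ s, g x = 0) :
    MinimallyDependent F f s := by
  refine ⟨fun hli => ?_, fun j hj => ?_⟩
  · obtain ⟨x, hx, hne⟩ := hc'
    exact hne (linearIndepOn_finset_iff.1 hli c hc x hx)
  · refine linearIndepOn_finset_iff.2 fun g hg x hx => ?_
    have hsum : ∑ y ∈ s, Function.update g j 0 y • f y = 0 := by
      rw [← Finset.add_sum_erase s _ hj, Function.update_self, zero_smul, zero_add, ← hg]
      refine Finset.sum_congr rfl fun y hy => ?_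
      rw [Function.update_of_ne (Finset.ne_of_mem_erase hy)]
    have hx0 := h _ hsum j hj (Function.update_self ..) x (Finset.mem_of_mem_erase hx)
    rwa [Function.update_of_ne (Finset.ne_of_mem_erase hx)] at hx0

theorem pFanoCol_of_lt (F : Type*) [Field F] {p : ℕ} (i : Fin (p + 1))
    (h : (i : ℕ) < 2 * p + 3) : pFanoCol F p ⟨i, h⟩ = Pi.single i 1 := by
  simp only [pFanoCol]
  rw [dif_pos i.isLt]

theorem pFanoCol_reflect (F : Type*) [Field F] {p : ℕ} (i : Fin (p + 1))
    (h : 2 * p + 1 - (i : ℕ) < 2 * p + 3) :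
    pFanoCol F p ⟨2 * p + 1 - i, h⟩ = (fun _ => 1) - Pi.single i 1 := by
  have hi := i.isLt
  have hrev : p - (2 * p + 1 - (i : ℕ) - (p + 1)) = i := by omega
  simp only [pFanoCol]
  rw [dif_neg (by omega), if_pos (by omega)]
  simp only [hrev]

theorem pFanoCol_add (F : Type*) [Field F] {p : ℕ} (j : Fin (p + 1))
    (h : p + 1 + (j : ℕ) < 2 * p + 3) :
    pFanoCol F p ⟨p + 1 + j, h⟩ = (fun _ => 1) - Pi.single j.rev 1 := by
  have hj := j.isLt
  have hrev : (⟨p - (p + 1 + (j : ℕ) - (p + 1)), by omega⟩ : Fin (p + 1)) = j.rev := by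
    ext
    simp only [Fin.val_rev]
    omega
  simp only [pFanoCol]
  rw [dif_neg (by omega), if_pos (by omega), hrev]

theorem pFanoCol_last (F : Type*) [Field F] {p : ℕ} (h : 2 * p + 2 < 2 * p + 3) :
    pFanoCol F p ⟨2 * p + 2, h⟩ = fun _ => 1 := by
  simp only [pFanoCol]
  rw [dif_neg (by omega), if_neg (by omega)]

theorem minimallyDependent_basis_exchange (F : Type*) [Field F] {p : ℕ}
    (i : Fin (p + 1)) (hlt : ∀ j : Fin (p + 1), (j : ℕ) < 2 * p + 3)
    (hcompl : 2 * p + 1 - (i : ℕ) < 2 * p + 3) : MinimallyDependent F (pFanoCol F p)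
      (insert (⟨2 * p + 1 - (i : ℕ), hcompl⟩ : Fin (2 * p + 3))
        ((Finset.univ.erase i).image
          (fun j : Fin (p + 1) => (⟨j, hlt j⟩ : Fin (2 * p + 3))))) := by
  have hi := i.isLt
  have hsum (g : Fin (2 * p + 3) → F) : ∑ x ∈ insert
      (⟨2 * p + 1 - (i : ℕ), hcompl⟩ : Fin (2 * p + 3))
        ((Finset.univ.erase i).image
          (fun j : Fin (p + 1) => (⟨j, hlt j⟩ : Fin (2 * p + 3)))),
      g x • pFanoCol F p x = fun k => if k = i then 0 else
        g ⟨2 * p + 1 - i, hcompl⟩ + g ⟨k, hlt k⟩ := by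
    rw [Finset.sum_insert, Finset.sum_image]
    · simp only [pFanoCol_of_lt, pFanoCol_reflect]
      ext k
      by_cases hk : k = i <;>
        simp [Finset.sum_apply, Pi.single_apply, hk]
    · intro a _ b _ hab
      simpa [Fin.ext_iff] using hab
    · simp only [Finset.mem_image, not_exists, not_and, Fin.mk.injEq]
      intro x _
      have := x.isLt
      omega
  refine minimallyDependent_of_relations
    (fun x => if (x : ℕ) < p + 1 then -1 else 1) ?_ ?_ fun g hg => ?_
  · rw [hsum]
    ext k
    have hge : ¬ (2 * p + 1 - (i : ℕ) < p + 1) := by omega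
    simp [hge, Fin.is_le k]
  · refine ⟨_, Finset.mem_insert_self _ _, ?_⟩
    dsimp only
    split_ifs <;> simp
  · have hg' (k : Fin (p + 1)) (hk : k ≠ i) :
        g ⟨2 * p + 1 - i, hcompl⟩ + g ⟨k, hlt k⟩ = 0 := by
      simpa [hk] using congrFun ((hsum g).symm.trans hg) k
    intro j hj hj0
    have h0 : g ⟨2 * p + 1 - i, hcompl⟩ = 0 := by
      simp only [Finset.mem_insert, Finset.mem_image, Finset.mem_erase] at hj
      obtain rfl | ⟨k, ⟨hk, -⟩, rfl⟩ := hj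
      · exact hj0
      · simpa [hj0] using hg' k hk
    intro x hx
    simp only [Finset.mem_insert, Finset.mem_image, Finset.mem_erase] at hx
    obtain rfl | ⟨k, ⟨hk, -⟩, rfl⟩ := hx
    · exact h0
    · simpa [h0] using hg' k hk

theorem minimallyDependent_triple (F : Type*) [Field F] {p : ℕ} (hp : p ≠ 0)
    (i : Fin (p + 1)) (hlt : (i : ℕ) < 2 * p + 3)
    (hcompl : 2 * p + 1 - (i : ℕ) < 2 * p + 3) (hlast : 2 * p + 2 < 2 * p + 3) :
    MinimallyDependent F (pFanoCol F p)
      ({⟨i, hlt⟩, ⟨2 * p + 1 - (i : ℕ), hcompl⟩,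
        ⟨2 * p + 2, hlast⟩} : Finset (Fin (2 * p + 3))) := by
  have hi := i.isLt
  have hsum (g : Fin (2 * p + 3) → F) : ∑ x ∈ ({⟨i, hlt⟩,
      ⟨2 * p + 1 - (i : ℕ), hcompl⟩, ⟨2 * p + 2, hlast⟩} : Finset (Fin (2 * p + 3))),
      g x • pFanoCol F p x = fun k => if k = i
        then g ⟨i, hlt⟩ + g ⟨2 * p + 2, hlast⟩
        else g ⟨2 * p + 1 - i, hcompl⟩ + g ⟨2 * p + 2, hlast⟩ := by
    rw [Finset.sum_insert, Finset.sum_pair]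
    · simp only [pFanoCol_of_lt, pFanoCol_reflect, pFanoCol_last]
      ext k
      by_cases hk : k = i <;> simp [hk]
    · simp only [ne_eq, Fin.mk.injEq]
      omega
    · simp only [Finset.mem_insert, Finset.mem_singleton, Fin.mk.injEq]
      omega
  refine minimallyDependent_of_relations
    (fun x => if (x : ℕ) < 2 * p + 2 then -1 else 1) ?_ ?_ fun g hg => ?_
  · rw [hsum]
    ext k
    have hi' : (i : ℕ) < 2 * p + 2 := by omega
    have hcompl' : 2 * p + 1 - (i : ℕ) < 2 * p + 2 := by omega
    simp [hi', hcompl']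
  · refine ⟨_, Finset.mem_insert_self _ _, ?_⟩
    dsimp only
    split_ifs <;> simp
  · have hg' := fun k => congrFun ((hsum g).symm.trans hg) k
    have : Nontrivial (Fin (p + 1)) := Fin.nontrivial_iff_two_le.2 (by omega)
    obtain ⟨k, hk⟩ := exists_ne i
    have hself := hg' i
    have hother := hg' k
    simp only [if_true, hk, if_false, Pi.zero_apply] at hself hother
    simp only [Finset.mem_insert, Finset.mem_singleton]
    rintro j (rfl | rfl | rfl) hj x (rfl | rfl | rfl) <;> grind

theorem minimallyDependent_complements (F : Type*) [Field F] (p : ℕ) [CharP F p]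
    (hlt : ∀ j : Fin (p + 1), p + 1 + (j : ℕ) < 2 * p + 3) :
    MinimallyDependent F (pFanoCol F p)
      (Finset.univ.image
        (fun j : Fin (p + 1) =>
          (⟨p + 1 + (j : ℕ), hlt j⟩ : Fin (2 * p + 3)))) := by
  have hsum (g : Fin (2 * p + 3) → F) : ∑ x ∈ Finset.univ.image
        (fun j : Fin (p + 1) =>
          (⟨p + 1 + (j : ℕ), hlt j⟩ : Fin (2 * p + 3))),
      g x • pFanoCol F p x = fun k => ∑ j : Fin (p + 1), g ⟨p + 1 + j, hlt j⟩ -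
        g ⟨p + 1 + k.rev, hlt k.rev⟩ := by
    rw [Finset.sum_image]
    · simp only [pFanoCol_add]
      ext k
      simp [Finset.sum_apply, Pi.single_apply, mul_sub, Finset.sum_sub_distrib,
        ← Fin.rev_eq_iff]
    · intro a _ b _ hab
      have := congrArg Fin.val hab
      ext
      simpa using this
  refine minimallyDependent_of_relations (fun _ => 1) ?_ ?_ fun g hg => ?_
  · rw [hsum]
    ext k
    simp
  · exact ⟨_, Finset.mem_image_of_mem _ (Finset.mem_univ 0), one_ne_zero⟩
  · have hg' (k : Fin (p + 1)) : g ⟨p + 1 + k, hlt k⟩ =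
        ∑ j : Fin (p + 1), g ⟨p + 1 + j, hlt j⟩ := by
      have := congrFun ((hsum g).symm.trans hg) k.rev
      simpa using (sub_eq_zero.1 this).symm
    simp only [Finset.mem_image, Finset.mem_univ, true_and]
    rintro _ ⟨j, rfl⟩ hj _ ⟨k, rfl⟩
    rw [hg' k, ← hg' j, hj]

/-- Over a field of characteristic p (p prime), H_p is a scalar linear representation of
the class p-Fano matroid: (a) columns [p+1] form a basis; (b) each
([p+1]\{i}) ∪ {2p+3-i} is a circuit; (c) each {i, 2p+3-i, 2p+3} is a circuit;
(d) [p+2:2p+2] is a circuit (0-based: {i, 2p+1-i, 2p+2} and columns p+1,…,2p+1). -/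
theorem pFano_matrix_represents (F : Type*) [Field F] (p : ℕ) (hp : p.Prime) [CharP F p] :
    (LinearIndependent F
        (fun i : Fin (p + 1) => pFanoCol F p ⟨i, by have := i.isLt; omega⟩) ∧
      Submodule.span F
        (Set.range (fun i : Fin (p + 1) => pFanoCol F p ⟨i, by have := i.isLt; omega⟩)) = ⊤) ∧
    (∀ i : Fin (p + 1), MinimallyDependent F (pFanoCol F p)
      (insert (⟨2 * p + 1 - (i : ℕ), by have := i.isLt; omega⟩ : Fin (2 * p + 3))
        ((Finset.univ.erase i).image
          (fun j : Fin (p + 1) => (⟨j, by have := j.isLt; omega⟩ : Fin (2 * p + 3)))))) ∧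
    (∀ i : Fin (p + 1), MinimallyDependent F (pFanoCol F p)
      ({⟨i, by have := i.isLt; omega⟩, ⟨2 * p + 1 - (i : ℕ), by have := i.isLt; omega⟩,
        ⟨2 * p + 2, by omega⟩} : Finset (Fin (2 * p + 3)))) ∧
    MinimallyDependent F (pFanoCol F p)
      (Finset.univ.image
        (fun j : Fin (p + 1) => (⟨p + 1 + (j : ℕ), by have := j.isLt; omega⟩ : Fin (2 * p + 3)))) := by
  have hbasis : (fun i : Fin (p + 1) => pFanoCol F p ⟨i, by have := i.isLt; omega⟩) =
      Pi.basisFun F (Fin (p + 1)) := by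
    ext1 i
    rw [pFanoCol_of_lt, Pi.basisFun_apply]
  rw [hbasis]
  exact ⟨⟨Module.Basis.linearIndependent _, Module.Basis.span_eq _⟩,
    fun i => minimallyDependent_basis_exchange F i _ _,
    fun i => minimallyDependent_triple F hp.ne_zero i _ _ _,
    minimallyDependent_complements F p _⟩
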